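/- arXiv:2004.04252 — 3 statements merged into one kernel-verified Lean document; each statement's English description precedes it below -/
import Mathlib

section
/- Let G be a finite group and let A, A' be finitely generated left ℤG-modules. Suppose A ≅ A₀ ⊕ ℤG for some ℤG-module A₀, and that for all but finitely many primes p the ℤ_(p)G-module ℤ_(p) ⊕ (ℤ_(p) ⊗_ℤ A₀) is free, where ℤ_(p) is the localization of ℤ at p, ℤ_(p) carries the trivial G-action, and G acts on ℤ_(p) ⊗_ℤ A₀ through A₀. Then A ⊕ ℤG ≅ A' ⊕ ℤG implies A ≅ A'. -/
/-!
STATEMENT 5: Let `G` be a finite group and `A ≅ A₀ ⊕ ℤG`, `A'` finitely generated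
`ℤG`-modules.  If for all but finitely many primes `p` the `ℤ_(p)G`-module
`ℤ_(p) ⊕ (ℤ_(p) ⊗_ℤ A₀)` is free (with trivial `G`-action on `ℤ_(p)` and `G` acting
through `A₀` on the tensor factor), then `A ⊕ ℤG ≅ A' ⊕ ℤG` implies `A ≅ A'`.
-/

noncomputable section

open MonoidAlgebra

/-- The localisation `ℤ_(p)` of `ℤ` at the prime `p`. -/
abbrev Zloc (p : ℕ) (hp : p.Prime) : Type :=
  @Localization.AtPrime ℤ _ (Ideal.span {(p : ℤ)})
    ((Ideal.span_singleton_prime (by exact_mod_cast hp.ne_zero)).mpr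
      (Nat.prime_iff_prime_int.mp hp))

/-- The action of `g : G` on a `ℤG`-module `A`, as a `ℤ`-linear endomorphism. -/
def gAct (G : Type) [Group G] (A : Type) [AddCommGroup A]
    [Module (MonoidAlgebra ℤ G) A] (g : G) : A →ₗ[ℤ] A :=
  AddMonoidHom.toIntLinearMap
    { toFun := fun x => MonoidAlgebra.of ℤ G g • x
      map_zero' := smul_zero _
      map_add' := fun x y => smul_add _ x y }

/-- The representation of `G` on `S ⊗_ℤ B` for a `ℤG`-module `B` and a commutative ring
`S`, where `G` acts through `B`. -/
def tensorRep (G : Type) [Group G] (S : Type) [CommRing S] (B : Type) [AddCommGroup B]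
    [Module (MonoidAlgebra ℤ G) B] :
    Representation S G (TensorProduct ℤ S B) where
  toFun g := LinearMap.baseChange S (gAct G B g)
  map_one' := by
    ext x
    show (1 : S) ⊗ₜ[ℤ] (MonoidAlgebra.single (1 : G) (1 : ℤ) • x) = 1 ⊗ₜ[ℤ] x
    rw [← MonoidAlgebra.one_def, one_smul]
  map_mul' g h := by
    ext x
    show (1 : S) ⊗ₜ[ℤ] (MonoidAlgebra.single (g * h) (1 : ℤ) • x)
      = (1 : S) ⊗ₜ[ℤ] (MonoidAlgebra.single g (1 : ℤ) • MonoidAlgebra.single h (1 : ℤ) • x)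
    rw [← mul_smul, MonoidAlgebra.single_mul_single, one_mul]

/-- The representation of `G` on `S ⊕ (S ⊗_ℤ B)` for a `ℤG`-module `B`: `G` acts
trivially on the first factor and through `B` on the second. -/
def trivSumTensorRep (G : Type) [Group G] (S : Type) [CommRing S] (B : Type)
    [AddCommGroup B] [Module (MonoidAlgebra ℤ G) B] :
    Representation S G (S × TensorProduct ℤ S B) where
  toFun g := LinearMap.prodMap LinearMap.id (LinearMap.baseChange S (gAct G B g))
  map_one' := by
    have h1 : (tensorRep G S B) 1 = LinearMap.id := map_one _
    show LinearMap.prodMap LinearMap.id ((tensorRep G S B) 1) = LinearMap.id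
    rw [h1, LinearMap.prodMap_id]
  map_mul' g h := by
    have h2 : (tensorRep G S B) (g * h) = (tensorRep G S B g) * (tensorRep G S B h) :=
      map_mul _ _ _
    show LinearMap.prodMap LinearMap.id ((tensorRep G S B) (g * h)) = _
    rw [h2]
    ext x <;> rfl

/-- A semisimple ring is von Neumann regular. -/
theorem IsSemisimpleRing.exists_mul_mul_eq_self {R : Type*} [Ring R] [IsSemisimpleRing R]
    (a : R) : ∃ z, a * z * a = a := by
  obtain ⟨C, hC⟩ := exists_isCompl (Ideal.span {a})
  have h1 : (1 : R) ∈ Ideal.span {a} ⊔ C := by rw [hC.sup_eq_top]; trivial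
  obtain ⟨e, he, c, hc, hec⟩ := Submodule.mem_sup.mp h1
  obtain ⟨z, rfl⟩ := Ideal.mem_span_singleton'.mp he
  refine ⟨z, ?_⟩
  have hac : a * c = a - a * z * a := by
    rw [← eq_sub_iff_add_eq'] at hec
    rw [hec, mul_sub, mul_one, mul_assoc]
  have h0 : a * c ∈ Ideal.span {a} ⊓ C := by
    refine ⟨?_, C.mul_mem_left a hc⟩
    rw [hac]
    exact sub_mem (Ideal.mem_span_singleton_self a)
      (Ideal.mul_mem_left _ _ (Ideal.mem_span_singleton_self a))
  rw [hC.inf_eq_bot, Submodule.mem_bot, hac, sub_eq_zero] at h0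
  exact h0.symm

theorem isUnit_of_mul_eq_one_of_finite {R : Type*} [Ring R] [Finite R] {a b : R}
    (h : a * b = 1) : IsUnit a :=
  ⟨⟨a, b, h, mul_eq_one_symm h⟩, rfl⟩

/-- A finite von Neumann regular ring has stable rank one. -/
theorem exists_isUnit_add_mul_of_regular {R : Type*} [Ring R] [Finite R]
    (hreg : ∀ a : R, ∃ z, a * z * a = a) {a b r s : R} (h : a * r + b * s = 1) :
    ∃ t, IsUnit (a + b * t) := by
  let S : R → Set R := fun t => Set.range fun x => (a + b * t) * x
  obtain ⟨t, ht⟩ := Finite.exists_max fun t => (S t).ncard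
  refine ⟨t, ?_⟩
  set a' := a + b * t with ha'
  have h' : a' * r + b * (s - t * r) = 1 := by rw [← h, ha']; noncomm_ring
  obtain ⟨z, hz⟩ := hreg a'
  have hae : a' * (1 - z * a') = 0 := by rw [mul_sub, mul_one, ← mul_assoc, hz, sub_self]
  -- every `b * q * e` lies in the right ideal generated by `a'`, by maximality
  have key : ∀ q, b * q * (1 - z * a') ∈ S t := by
    intro q
    by_contra hq
    have hsub : S t ⊂ S (t + q * (1 - z * a')) := by
      refine Set.ssubset_iff_of_subset ?_ |>.mpr ⟨_, ⟨1 - z * a', ?_⟩, hq⟩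
      · rintro _ ⟨x, rfl⟩
        refine ⟨z * a' * x, ?_⟩
        have : (1 - z * a') * (z * a') = 0 := by
          rw [sub_mul, one_mul, mul_assoc, ← mul_assoc a', hz, sub_self]
        calc (a + b * (t + q * (1 - z * a'))) * (z * a' * x)
            = a' * z * a' * x + b * q * ((1 - z * a') * (z * a')) * x := by
              rw [ha']; noncomm_ring
          _ = a' * x := by rw [this, hz]; simp
      · have : (1 - z * a') * (1 - z * a') = 1 - z * a' := by
          rw [mul_sub, mul_one, sub_mul, one_mul, mul_assoc, ← mul_assoc a', hz, sub_self,
            sub_zero]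
        calc (a + b * (t + q * (1 - z * a'))) * (1 - z * a')
            = a' * (1 - z * a') + b * q * ((1 - z * a') * (1 - z * a')) := by
              rw [ha']; noncomm_ring
          _ = b * q * (1 - z * a') := by rw [this, hae, zero_add]
    exact absurd (Set.ncard_lt_ncard hsub (Set.toFinite _)) (not_lt.mpr (ht _))
  let J : Ideal R := Ideal.span {y | ∃ q, y = (1 - z * a') * q}
  have hJ : ∀ j ∈ J, ∀ c : R, c * j ∈ S t := by
    intro j hj
    induction hj using Submodule.span_induction with
    | mem y hy =>
      obtain ⟨q, rfl⟩ := hy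
      intro c
      obtain ⟨w, hw⟩ := key ((s - t * r) * c)
      refine ⟨r * (c * ((1 - z * a') * q)) + w * q, ?_⟩
      calc a' * (r * (c * ((1 - z * a') * q)) + w * q)
          = a' * r * (c * ((1 - z * a') * q)) + (a' * w) * q := by noncomm_ring
        _ = (a' * r + b * (s - t * r)) * (c * ((1 - z * a') * q)) := by
          rw [show a' * w = _ from hw]; noncomm_ring
        _ = _ := by rw [h', one_mul]
    | zero => exact fun c => ⟨0, by simp⟩
    | add x y _ _ hx hy =>
      intro c
      obtain ⟨x', hx'⟩ := hx c
      obtain ⟨y', hy'⟩ := hy c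
      exact ⟨x' + y', by simp only [mul_add] at hx' hy' ⊢; rw [hx', hy']⟩
    | smul d x _ hx =>
      intro c
      rw [smul_eq_mul, ← mul_assoc]
      exact hx _
  have hmem : ∀ j ∈ J, a' * j ∈ J := fun j hj => J.mul_mem_left _ hj
  let φ : J → J := fun j => ⟨a' * j, hmem j j.2⟩
  have hsurj : Function.Surjective φ := by
    rintro ⟨j, hj⟩
    obtain ⟨x, hx⟩ := hJ j hj 1
    obtain ⟨w, hw⟩ := hreg j
    refine ⟨⟨x * w * j, J.mul_mem_left _ hj⟩, Subtype.ext ?_⟩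
    change a' * (x * w * j) = j
    rw [← mul_assoc, ← mul_assoc, show a' * x = _ from hx, one_mul, hw]
  have he : (1 - z * a') ∈ J := Ideal.subset_span ⟨1, (mul_one _).symm⟩
  have h0 : (⟨1 - z * a', he⟩ : J) = 0 :=
    (Finite.injective_iff_surjective.mpr hsurj) (Subtype.ext (by simpa [φ] using hae))
  have hza : z * a' = 1 := (sub_eq_zero.mp (congrArg Subtype.val h0)).symm
  exact isUnit_of_mul_eq_one_of_finite (mul_eq_one_symm hza)

/-- A finite ring has stable rank one. -/
theorem exists_isUnit_add_mul_of_finite {R : Type*} [Ring R] [Finite R]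
    {a b r s : R} (h : a * r + b * s = 1) : ∃ t, IsUnit (a + b * t) := by
  let π : R →+* R ⧸ Ring.jacobson R := Ideal.Quotient.mk _
  have hs : IsSemisimpleRing (R ⧸ Ring.jacobson R) := IsSemiprimaryRing.isSemisimpleRing
  have hπ : π a * π r + π b * π s = 1 := by simp only [← map_mul, ← map_add, h, map_one]
  have : Finite (R ⧸ Ring.jacobson R) := Finite.of_surjective _ Ideal.Quotient.mk_surjective
  obtain ⟨t, ht⟩ := exists_isUnit_add_mul_of_regular
    (fun x => IsSemisimpleRing.exists_mul_mul_eq_self x) hπ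
  obtain ⟨t, rfl⟩ := Ideal.Quotient.mk_surjective t
  obtain ⟨u, hu⟩ := ht.exists_right_inv
  obtain ⟨u, rfl⟩ := Ideal.Quotient.mk_surjective u
  refine ⟨t, ?_⟩
  have hmem : (a + b * t) * u - 1 ∈ Ring.jacobson R := by
    rw [← Ideal.Quotient.eq_zero_iff_mem, map_sub, map_mul, map_add, map_mul, map_one]
    exact sub_eq_zero.mpr hu
  obtain ⟨n, hn⟩ := IsSemiprimaryRing.isNilpotent (R := R)
  have hnil : IsNilpotent ((a + b * t) * u - 1) :=
    ⟨n, by simpa [hn] using Ideal.pow_mem_pow hmem n⟩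
  have hunit : IsUnit ((a + b * t) * u) := by simpa using hnil.isUnit_add_one
  obtain ⟨w, hw⟩ := hunit.exists_right_inv
  exact isUnit_of_mul_eq_one_of_finite (by rw [← mul_assoc, hw])

/-- Stable rank one modulo a non-zero integer, for a ring that is finite over `ℤ`. -/
theorem exists_add_mul_mul_eq_one_add {Λ : Type*} [Ring Λ] [Module.Finite ℤ Λ] {m : ℤ}
    (hm : m ≠ 0) {a b r s w : Λ} (h : a * r + b * s = 1 + m * w) :
    ∃ t u z : Λ, (a + b * t) * u = 1 + m * z := by
  let I : Ideal Λ := Ideal.span {(m : Λ)}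
  have hI : I.IsTwoSided := ⟨fun {x} c hx => by
    obtain ⟨y, rfl⟩ := Ideal.mem_span_singleton'.mp hx
    refine Ideal.mem_span_singleton'.mpr ⟨y * c, ?_⟩
    rw [mul_assoc, mul_assoc, (Int.cast_commute m c).eq]⟩
  have : Finite (Λ ⧸ I) := by
    have : Module.Finite ℤ (Λ ⧸ I) :=
      Module.Finite.of_surjective (Ideal.Quotient.mk I).toAddMonoidHom.toIntLinearMap
        Ideal.Quotient.mk_surjective
    refine Module.finite_of_fg_torsion _ fun x => ⟨⟨m, mem_nonZeroDivisors_of_ne_zero hm⟩, ?_⟩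
    obtain ⟨x, rfl⟩ := Ideal.Quotient.mk_surjective x
    change m • Ideal.Quotient.mk I x = 0
    rw [← map_zsmul, Ideal.Quotient.eq_zero_iff_mem, zsmul_eq_mul, (Int.cast_commute m x).eq]
    exact Ideal.mul_mem_left _ _ (Ideal.mem_span_singleton_self _)
  let π : Λ →+* Λ ⧸ I := Ideal.Quotient.mk I
  have hπ : π a * π r + π b * π s = 1 := by
    rw [← map_mul, ← map_mul, ← map_add, h, map_add, map_one, (Int.cast_commute m w).eq,
      Ideal.Quotient.eq_zero_iff_mem.mpr
        (Ideal.mul_mem_left _ _ (Ideal.mem_span_singleton_self _)), add_zero]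
  obtain ⟨t, ht⟩ := exists_isUnit_add_mul_of_finite hπ
  obtain ⟨t, rfl⟩ := Ideal.Quotient.mk_surjective t
  obtain ⟨u, hu⟩ := ht.exists_right_inv
  obtain ⟨u, rfl⟩ := Ideal.Quotient.mk_surjective u
  have hmem : (a + b * t) * u - 1 ∈ I := by
    rw [← Ideal.Quotient.eq_zero_iff_mem, map_sub, map_mul, map_add, map_mul, map_one]
    exact sub_eq_zero.mpr hu
  obtain ⟨z, hz⟩ := Ideal.mem_span_singleton'.mp hmem
  exact ⟨t, u, z, by rw [(Int.cast_commute m z).eq, hz]; abel⟩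

/-- An element that is right invertible modulo `m` divides an integer coprime to `m`. -/
theorem exists_isCoprime_mul_eq_intCast {Λ : Type*} [Ring Λ] [Module.Free ℤ Λ]
    [Module.Finite ℤ Λ] {m : ℤ} {x u z : Λ} (h : x * u = 1 + m * z) :
    ∃ (n : ℤ) (v : Λ), IsCoprime n m ∧ x * v = n := by
  classical
  let b := Module.Free.chooseBasis ℤ Λ
  let L := Algebra.leftMulMatrix b
  let v : Λ := b.equivFun.symm ((L x).adjugate.mulVec (b.repr 1))
  refine ⟨(L x).det, v, ?_, ?_⟩
  · have h1 : L x * L u = 1 + m • L z := by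
      rw [← map_mul, h, map_add, map_one, ← zsmul_eq_mul, map_zsmul]
    have h2 : (((L x).det * (L u).det : ℤ) : ZMod m.natAbs) = 1 := by
      have hm : (m : ZMod m.natAbs) = 0 := by
        rw [ZMod.intCast_zmod_eq_zero_iff_dvd]; simp
      have hmap : (Int.castRingHom (ZMod m.natAbs)).mapMatrix (1 + m • L z) = 1 := by
        rw [map_add, map_one, map_zsmul, ← Int.cast_smul_eq_zsmul (ZMod m.natAbs), hm, zero_smul,
          add_zero]
      rw [← Matrix.det_mul, h1, ← eq_intCast (Int.castRingHom (ZMod m.natAbs)), RingHom.map_det,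
        hmap, Matrix.det_one]
    have h3 : m ∣ (L x).det * (L u).det - 1 := by
      rw [← Int.natAbs_dvd, ← ZMod.intCast_zmod_eq_zero_iff_dvd]
      rw [Int.cast_sub, h2]; simp
    obtain ⟨k, hk⟩ := h3
    exact ⟨(L u).det, -k, by linarith⟩
  · apply b.repr.injective
    apply DFunLike.coe_injective
    rw [← Algebra.leftMulMatrix_mulVec_repr]
    have hv : (b.repr v : _ → ℤ) = (L x).adjugate.mulVec (b.repr 1) :=
      b.equivFun.apply_symm_apply _
    rw [hv, Matrix.mulVec_mulVec, Matrix.mul_adjugate, Matrix.smul_mulVec, Matrix.one_mulVec,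
      ← mul_one (((L x).det : ℤ) : Λ), ← zsmul_eq_mul, map_zsmul]
    rfl

/-- Two vectors of a module lie in the same orbit of the automorphism group. -/
def SameAutOrbit (Λ : Type*) [Ring Λ] {M : Type*} [AddCommGroup M] [Module Λ M]
    (v w : M) : Prop :=
  ∃ e : M ≃ₗ[Λ] M, e v = w

/-- A vector is unimodular if some linear functional takes the value one on it. -/
def IsUnimodular (Λ : Type*) [Ring Λ] {M : Type*} [AddCommGroup M] [Module Λ M] (v : M) : Prop :=
  ∃ f : M →ₗ[Λ] Λ, f v = 1

section Orbits

variable {Λ : Type*} [Ring Λ] {M : Type*} [AddCommGroup M] [Module Λ M] {u v w : M}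

theorem SameAutOrbit.trans (h₁ : SameAutOrbit Λ u v) (h₂ : SameAutOrbit Λ v w) :
    SameAutOrbit Λ u w := by
  obtain ⟨e, rfl⟩ := h₁
  obtain ⟨e', rfl⟩ := h₂
  exact ⟨e.trans e', rfl⟩

theorem SameAutOrbit.isUnimodular (h : SameAutOrbit Λ v w) (hv : IsUnimodular Λ v) :
    IsUnimodular Λ w := by
  obtain ⟨e, rfl⟩ := h
  obtain ⟨f, hf⟩ := hv
  exact ⟨f ∘ₗ e.symm.toLinearMap, by simpa using hf⟩

theorem sameAutOrbit_add_of_sq_zero (N : M →ₗ[Λ] M) (hN : ∀ x, N (N x) = 0) (v : M) :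
    SameAutOrbit Λ v (v + N v) :=
  ⟨LinearEquiv.ofLinearMap (LinearMap.id + N) (LinearMap.id - N)
    (by ext x; simp [hN]) (by ext x; simp [hN]), rfl⟩

end Orbits

section Triples

variable {Λ : Type*} [Ring Λ] {P : Type*} [AddCommGroup P] [Module Λ P]

theorem IsUnimodular.exists_eq_one {a : P} {x y : Λ} (h : IsUnimodular Λ (a, x, y)) :
    ∃ (f : P →ₗ[Λ] Λ) (r s : Λ), f a + x * r + y * s = 1 := by
  obtain ⟨f, hf⟩ := h
  refine ⟨f ∘ₗ LinearMap.inl Λ P (Λ × Λ), f (0, 1, 0), f (0, 0, 1), ?_⟩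
  calc _ = f (a, 0, 0) + f (x • (0, 1, 0)) + f (y • (0, 0, 1)) := by
        rw [map_smul, map_smul]; rfl
    _ = f (a, x, y) := by rw [← map_add, ← map_add]; simp
    _ = 1 := hf

theorem sameAutOrbit_add_third (f : P →ₗ[Λ] Λ) (a : P) (x y r : Λ) :
    SameAutOrbit Λ (a, x, y) (a, x, y + (f a + x * r)) := by
  convert sameAutOrbit_add_of_sq_zero (LinearMap.inr Λ P (Λ × Λ) ∘ₗ LinearMap.inr Λ Λ Λ ∘ₗ
    LinearMap.coprod f (LinearMap.toSpanSingleton Λ Λ r ∘ₗ LinearMap.fst Λ Λ Λ))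
    (by simp) (a, x, y) using 1
  simp

theorem sameAutOrbit_add_second (a : P) (x y s : Λ) :
    SameAutOrbit Λ (a, x, y) (a, x + y * s, y) := by
  convert sameAutOrbit_add_of_sq_zero (LinearMap.inr Λ P (Λ × Λ) ∘ₗ LinearMap.inl Λ Λ Λ ∘ₗ
    LinearMap.toSpanSingleton Λ Λ s ∘ₗ LinearMap.snd Λ Λ Λ ∘ₗ LinearMap.snd Λ P (Λ × Λ))
    (by simp) (a, x, y) using 1
  simp

theorem sameAutOrbit_add_third_mul (a : P) (x y r : Λ) :
    SameAutOrbit Λ (a, x, y) (a, x, y + x * r) := by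
  simpa using sameAutOrbit_add_third 0 a x y r

theorem sameAutOrbit_add_first (a w : P) (x y : Λ) :
    SameAutOrbit Λ (a, x, y) (a + y • w, x, y) := by
  convert sameAutOrbit_add_of_sq_zero (LinearMap.inl Λ P (Λ × Λ) ∘ₗ
    LinearMap.toSpanSingleton Λ P w ∘ₗ LinearMap.snd Λ Λ Λ ∘ₗ LinearMap.snd Λ P (Λ × Λ))
    (by simp) (a, x, y) using 1
  simp

/-- If `(a, x)` is unimodular, then `(a, x, y)` lies in the orbit of the last basis vector. -/
theorem sameAutOrbit_last_of_eq_one {f : P →ₗ[Λ] Λ} {a : P} {x r : Λ} (h : f a + x * r = 1)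
    (y : Λ) : SameAutOrbit Λ (a, x, y) (0, 0, 1) := by
  have h1 := sameAutOrbit_add_third (LinearMap.toSpanSingleton Λ Λ (1 - y) ∘ₗ f) a x y
    (r * (1 - y))
  have h2 : y + ((LinearMap.toSpanSingleton Λ Λ (1 - y) ∘ₗ f) a + x * (r * (1 - y))) = 1 := by
    rw [LinearMap.comp_apply, LinearMap.toSpanSingleton_apply, smul_eq_mul, ← mul_assoc,
      ← add_mul, h, one_mul, add_sub_cancel]
  rw [h2] at h1
  have h3 := sameAutOrbit_add_second a x 1 (-x)
  rw [one_mul, add_neg_cancel] at h3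
  have h4 := sameAutOrbit_add_first a (-a) (0 : Λ) 1
  rw [one_smul, add_neg_cancel] at h4
  exact (h1.trans h3).trans h4

/-- The Euclidean algorithm on the last two augmentations. -/
theorem exists_sameAutOrbit_augmentation_eq_zero (ε : Λ →+* ℤ) (a : P) (x y : Λ) :
    ∃ x' y', SameAutOrbit Λ (a, x, y) (a, x', y') ∧ ε y' = 0 := by
  induction hn : (ε y).natAbs using Nat.strong_induction_on generalizing x y with
  | _ n ih =>
    by_cases hy : ε y = 0
    · exact ⟨x, y, ⟨LinearEquiv.refl Λ _, rfl⟩, hy⟩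
    let q : ℤ := ε x / ε y
    let x₁ : Λ := x + y * (1 - q)
    let y₁ : Λ := y + x₁ * (-1)
    have h1 : SameAutOrbit Λ (a, x, y) (a, x₁, y₁) :=
      (sameAutOrbit_add_second a x y (1 - q)).trans (sameAutOrbit_add_third_mul a x₁ y (-1))
    have hε : ε y₁ = -(ε x % ε y) := by
      simp only [y₁, x₁, q, map_add, map_mul, map_sub, map_one, map_neg, map_intCast,
        Int.emod_def, Int.cast_id]
      ring
    have hlt : (ε y₁).natAbs < n := by
      rw [hε, ← hn]
      have := Int.emod_nonneg (ε x) hy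
      have := Int.emod_lt_abs (ε x) hy
      rw [Int.natAbs_neg]
      rw [Int.abs_eq_natAbs] at this
      omega
    obtain ⟨x', y', h2, h3⟩ := ih _ hlt x₁ y₁ rfl
    exact ⟨x', y', h1.trans h2, h3⟩

theorem exists_sameAutOrbit_augmentation_eq_one (ε : Λ →+* ℤ) {a : P} {x y : Λ}
    (h : IsUnimodular Λ (a, x, y)) :
    ∃ x' y', SameAutOrbit Λ (a, x, y) (a, x', y') ∧ ε x' = 1 := by
  obtain ⟨x₁, y₁, h1, hy₁⟩ := exists_sameAutOrbit_augmentation_eq_zero ε a x y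
  obtain ⟨f, r, s, hfrs⟩ := (h1.isUnimodular h).exists_eq_one
  have h2 := sameAutOrbit_add_third f a x₁ y₁ r
  have hε : ε (y₁ + (f a + x₁ * r)) = 1 := by
    have := congrArg ε hfrs
    simp only [map_add, map_mul, hy₁, map_one] at this ⊢
    linarith
  have h3 := sameAutOrbit_add_second a x₁ (y₁ + (f a + x₁ * r)) ((1 - ε x₁ : ℤ) : Λ)
  exact ⟨_, _, (h1.trans h2).trans h3, by
    rw [map_add, map_mul, hε]; simp⟩

variable [Module.Finite ℤ Λ]

/-- The last coordinate can be made right invertible modulo a non-zero integer. -/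
theorem exists_sameAutOrbit_mul_eq_one_add {m : ℤ} (hm : m ≠ 0) {a : P} {x y : Λ}
    (h : IsUnimodular Λ (a, x, y)) :
    ∃ y' u z, SameAutOrbit Λ (a, x, y) (a, x, y') ∧ y' * u = 1 + m * z := by
  obtain ⟨f, r, s, hfrs⟩ := h.exists_eq_one
  obtain ⟨t, u, z, htu⟩ := exists_add_mul_mul_eq_one_add hm
    (a := y) (b := f a + x * r) (r := s) (s := 1) (w := 0)
    (by rw [mul_one, mul_zero, add_zero, add_comm, hfrs])
  refine ⟨_, u, z, ?_, htu⟩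
  convert sameAutOrbit_add_third (LinearMap.toSpanSingleton Λ Λ t ∘ₗ f) a x y (r * t) using 3
  simp [add_mul, mul_assoc]

/-- The middle coordinate can be made right invertible modulo a non-zero integer, with
augmentation one. -/
theorem exists_sameAutOrbit_augmentation_eq_one_mul_eq_one_add (ε : Λ →+* ℤ) {m : ℤ}
    (hm : m ≠ 0) {a : P} {x y : Λ} (h : IsUnimodular Λ (a, x, y)) :
    ∃ x' y' u z, SameAutOrbit Λ (a, x, y) (a, x', y') ∧ ε x' = 1 ∧ x' * u = 1 + m * z := by
  obtain ⟨x₁, y₁, h1, hx₁⟩ := exists_sameAutOrbit_augmentation_eq_one ε h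
  obtain ⟨y₂, u, z, h2, hu⟩ := exists_sameAutOrbit_mul_eq_one_add hm (h1.isUnimodular h)
  have h3 := sameAutOrbit_add_third_mul a x₁ y₂ (-(ε y₂ : Λ))
  have hε : ε (y₂ + x₁ * (-(ε y₂ : Λ))) = 0 := by simp [hx₁]
  obtain ⟨t, u', z', htu⟩ := exists_add_mul_mul_eq_one_add hm
    (a := x₁) (b := y₂ + x₁ * (-(ε y₂ : Λ))) (r := ε y₂ * u) (s := u) (w := z)
    (by rw [← hu]; noncomm_ring)
  have h4 := sameAutOrbit_add_second a x₁ (y₂ + x₁ * (-(ε y₂ : Λ))) t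
  exact ⟨_, _, u', z', ((h1.trans h2).trans h3).trans h4, by
    rw [map_add, map_mul, hε, hx₁, zero_mul, add_zero], htu⟩

variable [Module.Free ℤ Λ]

/-- Transitivity of the automorphism group on unimodular vectors, provided that `P` contains a
vector on which some functional takes a non-zero integral value up to a multiple of the norm. -/
theorem sameAutOrbit_last_of_isUnimodular (ε : Λ →+* ℤ) {N : Λ} (hN : ∀ x, x * N = ε x * N)
    {w : P} {β : P →ₗ[Λ] Λ} {D k : ℤ} (hD : D ≠ 0) (hβ : β w = D - k * N)
    {a : P} {x y : Λ} (h : IsUnimodular Λ (a, x, y)) :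
    SameAutOrbit Λ (a, x, y) (0, 0, 1) := by
  obtain ⟨x₁, y₁, u, z, h1, hx₁, hu⟩ :=
    exists_sameAutOrbit_augmentation_eq_one_mul_eq_one_add ε (m := 2 * D) (by omega) h
  obtain ⟨n, v, hn, hv⟩ := exists_isCoprime_mul_eq_intCast hu
  have hn0 : n ≠ 0 := by
    rintro rfl
    have := Int.isUnit_iff.mp (isCoprime_zero_left.mp hn)
    omega
  obtain ⟨y₂, u₂, z₂, h2, hu₂⟩ := exists_sameAutOrbit_mul_eq_one_add hn0 (h1.isUnimodular h)
  obtain ⟨i, j, hij⟩ : IsCoprime n D := hn.of_mul_right_right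
  let c : Λ := u₂ * (1 - β a) * j
  have h3 := sameAutOrbit_add_first a (c • w) x₁ y₂
  have hNx : x₁ * N = N := by rw [hN, hx₁, Int.cast_one, one_mul]
  -- modulo `n`, the new value of `β` is `1` up to an integral multiple of `N`
  refine ((h1.trans h2).trans h3).trans (sameAutOrbit_last_of_eq_one (f := β)
    (r := v * (i * (1 - β a) - z₂ * (1 - β a) * j * D) + N * (ε (y₂ * c) * k)) ?_ y₂)
  have hj : (j : Λ) * D = 1 - i * n := by
    rw [eq_sub_iff_add_eq', ← Int.cast_mul, ← Int.cast_mul, ← Int.cast_add, hij, Int.cast_one]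
  have hN' : y₂ * c * (k * N) = N * (ε (y₂ * c) * k) := by
    rw [(Int.cast_commute k N).eq, ← mul_assoc, hN, (Int.cast_commute _ N).eq, mul_assoc]
  have hcomm : (1 - β a) * (i * n) = n * (i * (1 - β a)) := by
    rw [← mul_assoc (n : Λ), ← Int.cast_mul, ← Int.cast_mul, mul_comm n i,
      (Int.cast_commute _ (1 - β a)).eq]
  have hc : y₂ * (c * (D - k * N)) =
      (1 - β a) - n * (i * (1 - β a)) + n * (z₂ * (1 - β a) * j * D) -
        N * (ε (y₂ * c) * k) := by
    calc y₂ * (c * (D - k * N))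
        = (y₂ * u₂) * ((1 - β a) * (j * D)) - y₂ * c * (k * N) := by
          simp only [c]; noncomm_ring
      _ = (1 - β a) * (j * D) + n * (z₂ * (1 - β a) * j * D) - N * (ε (y₂ * c) * k) := by
          rw [hu₂, hN', add_mul, one_mul]; simp only [mul_assoc]
      _ = _ := by rw [hj, mul_sub, mul_one, hcomm]
  rw [map_add, map_smul, map_smul, hβ, smul_eq_mul, smul_eq_mul, hc, mul_add, ← mul_assoc x₁ v,
    hv, ← mul_assoc x₁ N, hNx, mul_sub (n : Λ)]
  generalize (n : Λ) * (i * (1 - β a)) = p, (n : Λ) * (z₂ * (1 - β a) * j * D) = q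
  abel

end Triples

theorem LinearEquiv.fst_symm_apply_fst_apply {Λ : Type*} [Ring Λ] {A A' : Type*}
    [AddCommGroup A] [Module Λ A] [AddCommGroup A'] [Module Λ A']
    (e : (A × Λ) ≃ₗ[Λ] (A' × Λ)) (he : e (0, 1) = (0, 1)) (a : A) :
    (e.symm ((e (a, 0)).1, 0)).1 = a := by
  have h : ((e (a, 0)).1, (0 : Λ)) = e ((a, 0) - (e (a, 0)).2 • (0, 1)) := by
    rw [map_sub, map_smul, he]
    ext <;> simp
  rw [h, e.symm_apply_apply]
  simp

/-- Cancellation of a free summand of rank one from an isomorphism preserving the last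
coordinate vector. -/
theorem nonempty_linearEquiv_of_apply_zero_one {Λ : Type*} [Ring Λ] {A A' : Type*}
    [AddCommGroup A] [Module Λ A] [AddCommGroup A'] [Module Λ A']
    (e : (A × Λ) ≃ₗ[Λ] (A' × Λ)) (he : e (0, 1) = (0, 1)) : Nonempty (A ≃ₗ[Λ] A') := by
  refine ⟨LinearEquiv.ofLinearMap
    (LinearMap.fst Λ A' Λ ∘ₗ e.toLinearMap ∘ₗ LinearMap.inl Λ A Λ)
    (LinearMap.fst Λ A Λ ∘ₗ e.symm.toLinearMap ∘ₗ LinearMap.inl Λ A' Λ) ?_ ?_⟩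
  · ext a
    exact e.symm.fst_symm_apply_fst_apply (by rw [← he, e.symm_apply_apply]) a
  · ext a
    exact e.fst_symm_apply_fst_apply he a

/-- Cancellation of a free summand of rank one from `P ⊕ Λ ⊕ Λ`. -/
theorem nonempty_linearEquiv_of_prod_linearEquiv {Λ : Type*} [Ring Λ] [Module.Free ℤ Λ]
    [Module.Finite ℤ Λ] {P A A' : Type*} [AddCommGroup P] [Module Λ P] [AddCommGroup A]
    [Module Λ A] [AddCommGroup A'] [Module Λ A']
    (ε : Λ →+* ℤ) {N : Λ} (hN : ∀ x, x * N = ε x * N)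
    {w : P} {β : P →ₗ[Λ] Λ} {D k : ℤ} (hD : D ≠ 0) (hβ : β w = D - k * N)
    (eA : A ≃ₗ[Λ] P × Λ) (e : (A × Λ) ≃ₗ[Λ] (A' × Λ)) : Nonempty (A ≃ₗ[Λ] A') := by
  let E : (A × Λ) ≃ₗ[Λ] P × Λ × Λ :=
    (eA.prodCongr (LinearEquiv.refl Λ Λ)).trans (LinearEquiv.prodAssoc Λ P Λ Λ)
  have hE : E (0, 1) = (0, 0, 1) := by simp [E]
  have huni : IsUnimodular Λ (E (e.symm (0, 1))) :=
    ⟨LinearMap.snd Λ A' Λ ∘ₗ e.toLinearMap ∘ₗ E.symm.toLinearMap, by simp⟩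
  obtain ⟨g, hg⟩ := sameAutOrbit_last_of_isUnimodular ε hN hD hβ huni
  obtain ⟨f⟩ := nonempty_linearEquiv_of_apply_zero_one
    (((e.symm.trans E).trans g).trans E.symm) (by
      simp only [LinearEquiv.trans_apply]
      exact (E.symm_apply_eq).mpr (hg.trans hE.symm))
  exact ⟨f.symm⟩

section GroupRing

variable {G : Type} [Group G]

/-- An element of the group ring fixed by left translations is a multiple of the norm. -/
theorem eq_intCast_mul_sum_of_of_mul_eq [Fintype G] {x : MonoidAlgebra ℤ G}
    (hx : ∀ g, of ℤ G g * x = x) : x = (x.coeff 1 : ℤ) * ∑ g, of ℤ G g := by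
  ext g
  have h1 : x.coeff g = x.coeff 1 := by
    conv_lhs => rw [← hx g]
    simp [coeff_single_mul_apply]
  rw [← zsmul_eq_mul, coeff_smul, coeff_sum]
  simp [h1]

theorem mul_sum_of [Fintype G] (x : MonoidAlgebra ℤ G) :
    x * ∑ g, of ℤ G g = (lift ℤ ℤ G 1 x : ℤ) * ∑ g, of ℤ G g := by
  induction x using MonoidAlgebra.induction_on with
  | of g =>
    rw [Finset.mul_sum]
    simp only [← map_mul, lift_of, MonoidHom.one_apply, Int.cast_one, one_mul]
    exact Fintype.sum_equiv (Equiv.mulLeft g) _ _ fun _ => rfl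
  | add x y hx hy => rw [add_mul, hx, hy, map_add, Int.cast_add, add_mul]
  | smul r x hx => rw [smul_mul_assoc, hx, map_smul, smul_eq_mul, Int.cast_mul, zsmul_eq_mul,
      mul_assoc]

variable {S : Type} [CommRing S]

theorem exists_zsmul_eq_map (hS : ∀ s : S, ∃ d : ℤ, d ≠ 0 ∧ ∃ n : ℤ, d • s = n)
    (z : MonoidAlgebra S G) :
    ∃ d : ℤ, d ≠ 0 ∧ ∃ y, d • z = mapRingHom G (Int.castRingHom S) y := by
  induction z using MonoidAlgebra.induction_linear with
  | zero => exact ⟨1, one_ne_zero, 0, by simp⟩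
  | add x y hx hy =>
    obtain ⟨d, hd, x', hx⟩ := hx
    obtain ⟨e, he, y', hy⟩ := hy
    refine ⟨d * e, mul_ne_zero hd he, e • x' + d • y', ?_⟩
    rw [map_add, map_zsmul, map_zsmul, ← hx, ← hy]
    module
  | single g s =>
    obtain ⟨d, hd, n, hn⟩ := hS s
    exact ⟨d, hd, single g n, by rw [mapRingHom_single, smul_single, hn]; rfl⟩

theorem exists_zsmul_eq_one_tmul (hS : ∀ s : S, ∃ d : ℤ, d ≠ 0 ∧ ∃ n : ℤ, d • s = n)
    {B : Type} [AddCommGroup B] (ω : TensorProduct ℤ S B) :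
    ∃ d : ℤ, d ≠ 0 ∧ ∃ w : B, d • ω = 1 ⊗ₜ w := by
  induction ω using TensorProduct.induction_on with
  | zero => exact ⟨1, one_ne_zero, 0, by simp⟩
  | add x y hx hy =>
    obtain ⟨d, hd, x', hx⟩ := hx
    obtain ⟨e, he, y', hy⟩ := hy
    refine ⟨d * e, mul_ne_zero hd he, e • x' + d • y', ?_⟩
    rw [TensorProduct.tmul_add, TensorProduct.tmul_smul, TensorProduct.tmul_smul, ← hx, ← hy]
    module
  | tmul s a =>
    obtain ⟨d, hd, n, hn⟩ := hS s
    refine ⟨d, hd, n • a, ?_⟩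
    rw [TensorProduct.smul_tmul', hn, ← mul_one (n : S), ← zsmul_eq_mul, TensorProduct.smul_tmul]

/-- An equivariant map into `S[G]` becomes integral after multiplication by an integer. -/
theorem exists_linearMap_map_eq_zsmul [CharZero S]
    (hS : ∀ s : S, ∃ d : ℤ, d ≠ 0 ∧ ∃ n : ℤ, d • s = n)
    {B : Type} [AddCommGroup B] [Module (MonoidAlgebra ℤ G) B]
    [Module.Finite (MonoidAlgebra ℤ G) B] (f : B →+ MonoidAlgebra S G)
    (hf : ∀ x b, f (x • b) = mapRingHom G (Int.castRingHom S) x * f b) :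
    ∃ d : ℤ, d ≠ 0 ∧ ∃ β : B →ₗ[MonoidAlgebra ℤ G] MonoidAlgebra ℤ G,
      ∀ b, mapRingHom G (Int.castRingHom S) (β b) = d • f b := by
  let j := mapRingHom G (Int.castRingHom S)
  have hj : Function.Injective j :=
    map_injective (Int.castRingHom S : ℤ →+ S) Int.cast_injective
  have key : ∃ d : ℤ, d ≠ 0 ∧ ∀ b ∈ (⊤ : Submodule (MonoidAlgebra ℤ G) B),
      ∃ y, j y = d • f b := by
    refine Submodule.fg_induction
      (motive := fun (M : Submodule (MonoidAlgebra ℤ G) B) _ =>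
        ∃ d : ℤ, d ≠ 0 ∧ ∀ b ∈ M, ∃ y, j y = d • f b) ?_ ?_ ⊤ Module.Finite.fg_top
    · intro x
      obtain ⟨d, hd, y, hy⟩ := exists_zsmul_eq_map hS (f x)
      refine ⟨d, hd, fun b hb => ?_⟩
      obtain ⟨r, rfl⟩ := Submodule.mem_span_singleton.mp hb
      exact ⟨r * y, by rw [map_mul, hf, ← hy, mul_smul_comm]⟩
    · rintro M₁ _ M₂ _ ⟨d, hd, h₁⟩ ⟨e, he, h₂⟩
      refine ⟨d * e, mul_ne_zero hd he, fun b hb => ?_⟩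
      obtain ⟨b₁, hb₁, b₂, hb₂, rfl⟩ := Submodule.mem_sup.mp hb
      obtain ⟨y₁, hy₁⟩ := h₁ b₁ hb₁
      obtain ⟨y₂, hy₂⟩ := h₂ b₂ hb₂
      refine ⟨e • y₁ + d • y₂, ?_⟩
      rw [map_add, map_zsmul, map_zsmul, hy₁, hy₂, map_add]
      module
  obtain ⟨d, hd, h⟩ := key
  choose β hβ using fun b => h b trivial
  refine ⟨d, hd, { toFun := β, map_add' := fun b c => hj ?_, map_smul' := fun x b => hj ?_ }, hβ⟩
  · rw [map_add, hβ, hβ, hβ, map_add, smul_add]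
  · rw [RingHom.id_apply, smul_eq_mul, map_mul, hβ, hβ, hf, mul_smul_comm]

/-- If `S ⊕ (S ⊗ B)` is free over `S[G]`, then some functional on `B` takes a value that is a
non-zero integer up to a multiple of the norm. -/
theorem exists_linearMap_apply_eq_intCast_sub [Fintype G] [CharZero S]
    (hS : ∀ s : S, ∃ d : ℤ, d ≠ 0 ∧ ∃ n : ℤ, d • s = n)
    (B : Type) [AddCommGroup B] [Module (MonoidAlgebra ℤ G) B]
    [Module.Finite (MonoidAlgebra ℤ G) B]
    (hfree : Module.Free (MonoidAlgebra S G) (trivSumTensorRep G S B).asModule) :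
    ∃ (w : B) (β : B →ₗ[MonoidAlgebra ℤ G] MonoidAlgebra ℤ G) (D k : ℤ),
      D ≠ 0 ∧ β w = D - k * ∑ g, of ℤ G g := by
  have : Nontrivial S := ⟨⟨0, 1, zero_ne_one⟩⟩
  let ρ := trivSumTensorRep G S B
  let j := mapRingHom G (Int.castRingHom S)
  have hj : Function.Injective j :=
    map_injective (Int.castRingHom S : ℤ →+ S) Int.cast_injective
  let b := Module.Free.chooseBasis (MonoidAlgebra S G) ρ.asModule
  have : Nontrivial ρ.asModule := inferInstanceAs (Nontrivial (S × TensorProduct ℤ S B))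
  obtain ⟨i⟩ := b.index_nonempty
  let φ : S × TensorProduct ℤ S B →+ MonoidAlgebra S G :=
    (b.coord i).toAddMonoidHom.comp ρ.asModuleEquiv.symm.toLinearMap.toAddMonoidHom
  have hφ : ∀ g v, φ (ρ g v) = of S G g * φ v := by
    intro g v
    change b.coord i (ρ.asModuleEquiv.symm (ρ g v)) = _
    rw [Representation.asModuleEquiv_symm_map_rho, map_smul]
    rfl
  let ι : B →+ S × TensorProduct ℤ S B :=
    (AddMonoidHom.inr S (TensorProduct ℤ S B)).comp (TensorProduct.mk ℤ S B 1).toAddMonoidHom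
  have hf : ∀ x a, (φ.comp ι) (x • a) = j x * (φ.comp ι) a := by
    intro x a
    induction x using MonoidAlgebra.induction_linear with
    | zero => simp
    | add x y hx hy => rw [add_smul, map_add, hx, hy, map_add, add_mul]
    | single g n =>
      have h1 : (single g n : MonoidAlgebra ℤ G) = n • of ℤ G g := by simp
      have h2 : ι (of ℤ G g • a) = ρ g (ι a) := rfl
      have h3 : j (of ℤ G g) = of S G g := by simp [j]
      rw [h1, smul_assoc, map_zsmul, map_zsmul, h3, AddMonoidHom.comp_apply, h2, hφ,
        smul_mul_assoc]
      rfl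
  obtain ⟨d, hd, β, hβ⟩ := exists_linearMap_map_eq_zsmul hS (φ.comp ι) hf
  obtain ⟨e, he, w, hw⟩ := exists_zsmul_eq_one_tmul hS (ρ.asModuleEquiv (b i)).2
  let v : S × TensorProduct ℤ S B := ρ.asModuleEquiv (b i)
  have hv : φ v = 1 := by
    change b.coord i (ρ.asModuleEquiv.symm (ρ.asModuleEquiv (b i))) = 1
    simp
  have hsplit : e • v = (e • v.1, 0) + ι w := by
    ext
    · simp [ι]
    · simpa [ι] using hw
  let y : MonoidAlgebra ℤ G := (d * e : ℤ) - β w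
  have hy : j y = φ ((d * e) • v.1, 0) := by
    have h1 := congrArg φ hsplit
    rw [map_zsmul, hv, map_add] at h1
    have h2 : φ ((d * e) • v.1, 0) = d • φ (e • v.1, 0) := by
      rw [← map_zsmul, Prod.smul_mk, smul_zero, mul_smul]
    rw [h2, map_sub, map_intCast, hβ, AddMonoidHom.comp_apply, ← sub_eq_iff_eq_add.mpr h1]
    simp [smul_sub]
  have hinv : ∀ g, of ℤ G g * y = y := by
    intro g
    apply hj
    have h3 : j (of ℤ G g) = of S G g := by simp [j]
    rw [map_mul, hy, h3, ← hφ]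
    congr 1
  exact ⟨w, β, d * e, y.coeff 1, mul_ne_zero hd he, by
    rw [← eq_intCast_mul_sum_of_of_mul_eq hinv]; simp [y]⟩

end GroupRing

theorem Zloc.exists_zsmul_eq_intCast (p : ℕ) (hp : p.Prime) (s : Zloc p hp) :
    ∃ d : ℤ, d ≠ 0 ∧ ∃ n : ℤ, d • s = n := by
  have := (Ideal.span_singleton_prime (by exact_mod_cast hp.ne_zero)).mpr
      (Nat.prime_iff_prime_int.mp hp)
  obtain ⟨⟨n, d⟩, h⟩ := IsLocalization.surj (Ideal.span {(p : ℤ)}).primeCompl s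
  refine ⟨d, fun h0 => d.2 (by simp [h0]), n, ?_⟩
  rw [zsmul_eq_mul, mul_comm]
  simpa using h

theorem Zloc.charZero (p : ℕ) (hp : p.Prime) : CharZero (Zloc p hp) := by
  have := (Ideal.span_singleton_prime (by exact_mod_cast hp.ne_zero)).mpr
      (Nat.prime_iff_prime_int.mp hp)
  have h := IsLocalization.injective (Zloc p hp)
    (Ideal.primeCompl_le_nonZeroDivisors (Ideal.span {(p : ℤ)}))
  exact ⟨fun m n hmn => by
    have : algebraMap ℤ (Zloc p hp) m = algebraMap ℤ (Zloc p hp) n := by simpa using hmn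
    exact_mod_cast h this⟩

theorem cancellation_of_modules_with_locally_free_complement
    (G : Type) [Group G] [Finite G]
    (A A' A₀ : Type)
    [AddCommGroup A] [Module (MonoidAlgebra ℤ G) A]
    [AddCommGroup A'] [Module (MonoidAlgebra ℤ G) A']
    [AddCommGroup A₀] [Module (MonoidAlgebra ℤ G) A₀]
    [Module.Finite (MonoidAlgebra ℤ G) A] [Module.Finite (MonoidAlgebra ℤ G) A']
    (hA : Nonempty (A ≃ₗ[MonoidAlgebra ℤ G] (A₀ × MonoidAlgebra ℤ G)))
    (hloc : ∃ T : Finset ℕ, ∀ (p : ℕ) (hp : p.Prime), p ∉ T →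
      Module.Free (MonoidAlgebra (Zloc p hp) G)
        ((trivSumTensorRep G (Zloc p hp) A₀).asModule))
    (h : Nonempty ((A × MonoidAlgebra ℤ G) ≃ₗ[MonoidAlgebra ℤ G]
      (A' × MonoidAlgebra ℤ G))) :
    Nonempty (A ≃ₗ[MonoidAlgebra ℤ G] A') := by
  classical
  obtain ⟨eA⟩ := hA
  obtain ⟨e⟩ := h
  obtain ⟨T, hT⟩ := hloc
  obtain ⟨p, hp, hpT⟩ := Nat.infinite_setOfPred_prime.exists_notMem_finset T
  have := Fintype.ofFinite G
  have := Zloc.charZero p hp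
  have : Module.Finite (MonoidAlgebra ℤ G) A₀ :=
    Module.Finite.of_surjective
      (LinearMap.fst (MonoidAlgebra ℤ G) A₀ (MonoidAlgebra ℤ G) ∘ₗ eA.toLinearMap)
      fun a => ⟨eA.symm (a, 0), by simp⟩
  have : Module.Free ℤ (MonoidAlgebra ℤ G) := Module.Free.of_basis (MonoidAlgebra.basis G ℤ)
  have : Module.Finite ℤ (MonoidAlgebra ℤ G) := Module.Finite.of_basis (MonoidAlgebra.basis G ℤ)
  obtain ⟨w, β, D, k, hD, hβ⟩ := exists_linearMap_apply_eq_intCast_sub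
    (Zloc.exists_zsmul_eq_intCast p hp) A₀ (hT p hp hpT)
  exact nonempty_linearEquiv_of_prod_linearEquiv (lift ℤ ℤ G 1).toRingHom mul_sum_of hD hβ eA e

end
end

section
/- Let G be a finite group and let 0 → B →ⁱ E → A → 0 be a short exact sequence of left ℤG-modules in which A, B and E are ℤG-lattices (finitely generated with torsion-free underlying abelian group). Let P be a finitely generated projective ℤG-module and let f : B → P be a ℤG-module homomorphism. Then there exists a ℤG-module homomorphism f̃ : E → P with f̃ ∘ i = f. -/
section RelativeTrace

open MonoidAlgebra

variable {k : Type*} [CommRing k] {G : Type*} [Group G]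

/-- The `k`-linear endomorphism of `k[G]` that keeps only the coefficient of the identity. -/
noncomputable def MonoidAlgebra.identityComponent (k : Type*) [CommRing k] (G : Type*) [Group G] :
    MonoidAlgebra k G →ₗ[k] MonoidAlgebra k G where
  toFun x := single 1 (x.coeff 1)
  map_add' x y := by simp [single_add]
  map_smul' c x := by simp [smul_single]

theorem MonoidAlgebra.identityComponent_apply (x : MonoidAlgebra k G) :
    identityComponent k G x = single 1 (x.coeff 1) := rfl

variable [Fintype G]

theorem MonoidAlgebra.sumOfConjugates_identityComponent (x : MonoidAlgebra k G) :
    (identityComponent k G).sumOfConjugates G x = x := by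
  classical
  simp only [LinearMap.sumOfConjugates_apply, LinearMap.conjugate_apply, smul_eq_mul,
    identityComponent_apply, single_mul_single, mul_one, one_mul]
  induction x using MonoidAlgebra.induction_linear with
  | zero => simp
  | add x y hx hy =>
    simp only [mul_add, coeff_add, Finsupp.add_apply, single_add, Finset.sum_add_distrib, hx, hy]
  | single h r =>
    rw [Finset.sum_eq_single h⁻¹]
    · simp [single_mul_single]
    · intro g _ hg
      have : g * h ≠ 1 := fun e => hg (eq_inv_of_mul_eq_one_left e)
      simp [single_mul_single, this]
    · simp

variable {V W X : Type*}
  [AddCommGroup V] [Module k V] [Module (MonoidAlgebra k G) V]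
  [IsScalarTower k (MonoidAlgebra k G) V]
  [AddCommGroup W] [Module k W] [Module (MonoidAlgebra k G) W]
  [IsScalarTower k (MonoidAlgebra k G) W]
  [AddCommGroup X] [Module k X] [Module (MonoidAlgebra k G) X]
  [IsScalarTower k (MonoidAlgebra k G) X]

theorem LinearMap.sumOfConjugates_comp_equivariant (π : W →ₗ[k] V)
    (b : X →ₗ[MonoidAlgebra k G] W) (c : X →ₗ[k] V) (h : ∀ x, c x = π (b x)) (x : X) :
    c.sumOfConjugates G x = π.sumOfConjugates G (b x) := by
  simp only [sumOfConjugates_apply, conjugate_apply, h, map_smul]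

theorem LinearMap.sumOfConjugates_equivariant_comp (π : W →ₗ[k] V)
    (a : V →ₗ[MonoidAlgebra k G] X) (c : W →ₗ[k] X) (h : ∀ w, c w = a (π w)) (w : W) :
    c.sumOfConjugates G w = a (π.sumOfConjugates G w) := by
  simp only [sumOfConjugates_apply, conjugate_apply, h, map_smul, map_sum]

theorem Finsupp.sumOfConjugates_mapRange {ι : Type*} (π : V →ₗ[k] V) (x : ι →₀ V) :
    (mapRange.linearMap (α := ι) π).sumOfConjugates G x =
      mapRange.linearMap (π.sumOfConjugates G) x := by
  ext j
  simp [LinearMap.sumOfConjugates_apply, LinearMap.conjugate_apply, Finsupp.finsetSum_apply]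

/-- The identity of a projective `k[G]`-module is the trace of a `k`-linear endomorphism. -/
theorem Module.Projective.exists_sumOfConjugates_eq [Module.Projective (MonoidAlgebra k G) V] :
    ∃ θ : V →ₗ[k] V, ∀ v, θ.sumOfConjugates G v = v := by
  obtain ⟨s, hs⟩ := Module.projective_def.1 ‹Module.Projective (MonoidAlgebra k G) V›
  let r := Finsupp.linearCombination (MonoidAlgebra k G) (id : V → V)
  let t := Finsupp.mapRange.linearMap (α := V) (identityComponent k G)
  refine ⟨r.restrictScalars k ∘ₗ t ∘ₗ s.restrictScalars k, fun v => ?_⟩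
  rw [LinearMap.sumOfConjugates_equivariant_comp (t ∘ₗ s.restrictScalars k) r _ fun _ => rfl,
    LinearMap.sumOfConjugates_comp_equivariant t s _ fun _ => rfl,
    Finsupp.sumOfConjugates_mapRange]
  have : (identityComponent k G).sumOfConjugates G = LinearMap.id :=
    LinearMap.ext sumOfConjugates_identityComponent
  simpa [this] using hs v

/-- Projective `k[G]`-modules are injective relative to `k`-split monomorphisms. -/
theorem Module.Projective.exists_extension_of_leftInverse
    [Module.Projective (MonoidAlgebra k G) V] (i : W →ₗ[MonoidAlgebra k G] X) (ρ : X →ₗ[k] W)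
    (hρ : ∀ w, ρ (i w) = w) (f : W →ₗ[MonoidAlgebra k G] V) :
    ∃ F : X →ₗ[MonoidAlgebra k G] V, F ∘ₗ i = f := by
  obtain ⟨θ, hθ⟩ := Module.Projective.exists_sumOfConjugates_eq (k := k) (G := G) (V := V)
  refine ⟨(θ ∘ₗ f.restrictScalars k ∘ₗ ρ).sumOfConjugatesEquivariant G, LinearMap.ext fun w => ?_⟩
  rw [LinearMap.comp_apply, LinearMap.sumOfConjugatesEquivariant_apply,
    ← LinearMap.sumOfConjugates_apply]
  rw [← LinearMap.sumOfConjugates_comp_equivariant _ i (θ ∘ₗ f.restrictScalars k)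
      (fun w => by simp [hρ]),
    LinearMap.sumOfConjugates_comp_equivariant θ f _ (fun _ => rfl), hθ]

end RelativeTrace

/-!
STATEMENT 8: For a finite group `G`, a short exact sequence `0 → B → E → A → 0` of
`ℤG`-lattices and a finitely generated projective `ℤG`-module `P`, every homomorphism
`f : B → P` extends to `f̃ : E → P` with `f̃ ∘ i = f`.
(A `ℤG`-lattice is a finitely generated `ℤG`-module whose underlying abelian group is
torsion-free; torsion-freeness is expressed as `NoZeroSMulDivisors ℤ`.)
-/

theorem projective_relatively_injective_for_lattices
    (G : Type) [Group G] [Finite G]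
    (A B E P : Type)
    [AddCommGroup A] [Module (MonoidAlgebra ℤ G) A]
    [AddCommGroup B] [Module (MonoidAlgebra ℤ G) B]
    [AddCommGroup E] [Module (MonoidAlgebra ℤ G) E]
    [AddCommGroup P] [Module (MonoidAlgebra ℤ G) P]
    [Module.Finite (MonoidAlgebra ℤ G) A] [NoZeroSMulDivisors ℤ A]
    [Module.Finite (MonoidAlgebra ℤ G) B] [NoZeroSMulDivisors ℤ B]
    [Module.Finite (MonoidAlgebra ℤ G) E] [NoZeroSMulDivisors ℤ E]
    [Module.Finite (MonoidAlgebra ℤ G) P] [Module.Projective (MonoidAlgebra ℤ G) P]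
    (i : B →ₗ[MonoidAlgebra ℤ G] E) (π : E →ₗ[MonoidAlgebra ℤ G] A)
    (hi : Function.Injective i) (hπ : Function.Surjective π)
    (hexact : LinearMap.ker π = LinearMap.range i)
    (f : B →ₗ[MonoidAlgebra ℤ G] P) :
    ∃ ftilde : E →ₗ[MonoidAlgebra ℤ G] P, ftilde ∘ₗ i = f := by
  have := Fintype.ofFinite G
  have : Module.Finite ℤ A := Module.Finite.trans (MonoidAlgebra ℤ G) A
  have : Module.IsTorsionFree ℤ A := inferInstance
  obtain ⟨σ, hσ⟩ := Module.projective_lifting_property (π.restrictScalars ℤ) LinearMap.id hπ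
  have hex : Function.Exact (i.restrictScalars ℤ) (π.restrictScalars ℤ) :=
    (LinearMap.exact_iff.2 hexact : Function.Exact i π)
  have ⟨ρ, hρ⟩ : ∃ ρ : E →ₗ[ℤ] B, ρ ∘ₗ i.restrictScalars ℤ = LinearMap.id :=
    ((hex.split_tfae hi hπ).out 0 1 rfl rfl).1 ⟨σ, hσ⟩
  exact Module.Projective.exists_extension_of_leftInverse i ρ (LinearMap.congr_fun hρ) f
end

section
/- Let R₁, R₂, R₀ be rings, let j₁ : R₁ → R₀ be a surjective ring homomorphism and j₂ : R₂ → R₀ a ring homomorphism, and let R = {(x,y) ∈ R₁ × R₂ : j₁(x) = j₂(y)} be the pullback subring of R₁ × R₂. For a unit u ∈ R₀ˣ let M(u) = {(x,y) ∈ R₁ × R₂ : u · j₁(x) = j₂(y)}, an R-module under coordinatewise multiplication. Suppose α₁, α₂, α₀ are ring automorphisms of R₁, R₂, R₀ respectively satisfying j₁ ∘ α₁ = α₀ ∘ j₁ and j₂ ∘ α₂ = α₀ ∘ j₂, and let α be the induced ring automorphism (x,y) ↦ (α₁(x), α₂(y)) of R. Then M(u)_α ≅ M(α₀⁻¹(u))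 as R-modules, where M(u)_α is M(u) with the R-action r • m = α(r)·m. -/
/-!
STATEMENT 15: Milnor squares and twisted patching modules.  Given rings `R₁, R₂, R₀`,
a surjection `j₁ : R₁ → R₀`, a homomorphism `j₂ : R₂ → R₀`, the pullback ring
`R = {(x,y) : j₁ x = j₂ y}`, a unit `u ∈ R₀ˣ` and the patching `R`-module
`M(u) = {(x,y) : j₁(x)·u = j₂(y)}` (an `R`-submodule of `R₁ × R₂` under coordinatewise
multiplication), and compatible ring automorphisms `α₁, α₂, α₀` inducing
`α : (x,y) ↦ (α₁ x, α₂ y)` on `R`:  then `M(u)_α ≅ M(α₀⁻¹ u)` as `R`-modules, where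
`M(u)_α` is `M(u)` with the action `r • m = α(r) · m`.
-/

noncomputable section

variable (R₁ R₂ R₀ : Type) [Ring R₁] [Ring R₂] [Ring R₀]

/-- The pullback ring `R = {(x,y) ∈ R₁ × R₂ : j₁(x) = j₂(y)}`. -/
def pbRing (j₁ : R₁ →+* R₀) (j₂ : R₂ →+* R₀) : Subring (R₁ × R₂) :=
  RingHom.eqLocus (j₁.comp (RingHom.fst R₁ R₂)) (j₂.comp (RingHom.snd R₁ R₂))

/-- The Milnor patching module `M(u) = {(x,y) ∈ R₁ × R₂ : j₁(x)·u = j₂(y)}`, an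
`R`-submodule of `R₁ × R₂` under coordinatewise multiplication. -/
def milnorPatch (j₁ : R₁ →+* R₀) (j₂ : R₂ →+* R₀) (u : R₀) :
    Submodule ↥(pbRing R₁ R₂ R₀ j₁ j₂) (R₁ × R₂) where
  carrier := {z | j₁ z.1 * u = j₂ z.2}
  add_mem' := by
    intro a b ha hb
    show j₁ (a.1 + b.1) * u = j₂ (a.2 + b.2)
    rw [map_add, map_add, add_mul, ha, hb]
  zero_mem' := by
    show j₁ 0 * u = j₂ 0
    rw [map_zero, map_zero, zero_mul]
  smul_mem' := by
    intro c z hz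
    have hc : j₁ c.1.1 = j₂ c.1.2 := c.2
    show j₁ (c.1.1 * z.1) * u = j₂ (c.1.2 * z.2)
    rw [map_mul, map_mul, mul_assoc, hz, hc]

/-- The ring endomorphism of the pullback ring induced by compatible endomorphisms
`α₁, α₂` of `R₁, R₂`. -/
def pbRingMap (j₁ : R₁ →+* R₀) (j₂ : R₂ →+* R₀) (α₁ : R₁ ≃+* R₁) (α₂ : R₂ ≃+* R₂)
    (α₀ : R₀ ≃+* R₀) (h₁ : ∀ x, j₁ (α₁ x) = α₀ (j₁ x)) (h₂ : ∀ y, j₂ (α₂ y) = α₀ (j₂ y)) :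
    ↥(pbRing R₁ R₂ R₀ j₁ j₂) →+* ↥(pbRing R₁ R₂ R₀ j₁ j₂) where
  toFun z := ⟨(α₁ z.1.1, α₂ z.1.2), by
    have hz : j₁ z.1.1 = j₂ z.1.2 := z.2
    show j₁ (α₁ z.1.1) = j₂ (α₂ z.1.2)
    rw [h₁, h₂, hz]⟩
  map_one' := by
    apply Subtype.ext
    show (α₁ 1, α₂ 1) = (1, 1)
    rw [map_one, map_one]
  map_mul' a b := by
    apply Subtype.ext
    show (α₁ (a.1.1 * b.1.1), α₂ (a.1.2 * b.1.2)) = (α₁ a.1.1 * α₁ b.1.1, α₂ a.1.2 * α₂ b.1.2)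
    rw [map_mul, map_mul]
  map_zero' := by
    apply Subtype.ext
    show (α₁ 0, α₂ 0) = (0, 0)
    rw [map_zero, map_zero]
  map_add' a b := by
    apply Subtype.ext
    show (α₁ (a.1.1 + b.1.1), α₂ (a.1.2 + b.1.2)) = (α₁ a.1.1 + α₁ b.1.1, α₂ a.1.2 + α₂ b.1.2)
    rw [map_add, map_add]

/-- A module `M` over a ring `S` with the action twisted by a ring endomorphism `σ`:
the same underlying abelian group, with action `r • m = σ(r) • m`. -/
def twModule (S : Type) [Ring S] (_σ : S →+* S) (M : Type) [AddCommGroup M]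
    [Module S M] : Type := M

instance (S : Type) [Ring S] (σ : S →+* S) (M : Type) [AddCommGroup M] [Module S M] :
    AddCommGroup (twModule S σ M) := inferInstanceAs (AddCommGroup M)

noncomputable instance (S : Type) [Ring S] (σ : S →+* S) (M : Type) [AddCommGroup M]
    [Module S M] : Module S (twModule S σ M) := Module.compHom M σ

theorem mem_milnorPatch_symm_iff (j₁ : R₁ →+* R₀) (j₂ : R₂ →+* R₀)
    (α₁ : R₁ ≃+* R₁) (α₂ : R₂ ≃+* R₂) (α₀ : R₀ ≃+* R₀)
    (h₁ : ∀ x, j₁ (α₁ x) = α₀ (j₁ x)) (h₂ : ∀ y, j₂ (α₂ y) = α₀ (j₂ y))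
    (u : R₀) (z : R₁ × R₂) :
    z ∈ milnorPatch R₁ R₂ R₀ j₁ j₂ (α₀.symm u) ↔
      (α₁ z.1, α₂ z.2) ∈ milnorPatch R₁ R₂ R₀ j₁ j₂ u := by
  change j₁ z.1 * α₀.symm u = j₂ z.2 ↔ j₁ (α₁ z.1) * u = j₂ (α₂ z.2)
  rw [h₁, h₂, ← α₀.injective.eq_iff, map_mul, α₀.apply_symm_apply]

theorem twisted_milnor_patching_module
    (j₁ : R₁ →+* R₀) (j₂ : R₂ →+* R₀) (hj₁ : Function.Surjective j₁)
    (α₁ : R₁ ≃+* R₁) (α₂ : R₂ ≃+* R₂) (α₀ : R₀ ≃+* R₀)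
    (h₁ : ∀ x, j₁ (α₁ x) = α₀ (j₁ x)) (h₂ : ∀ y, j₂ (α₂ y) = α₀ (j₂ y))
    (u : R₀ˣ) :
    Nonempty ((twModule ↥(pbRing R₁ R₂ R₀ j₁ j₂)
        (pbRingMap R₁ R₂ R₀ j₁ j₂ α₁ α₂ α₀ h₁ h₂)
        ↥(milnorPatch R₁ R₂ R₀ j₁ j₂ (u : R₀)))
      ≃ₗ[↥(pbRing R₁ R₂ R₀ j₁ j₂)]
      ↥(milnorPatch R₁ R₂ R₀ j₁ j₂ (α₀.symm (u : R₀)))) := by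
  have hmem := mem_milnorPatch_symm_iff R₁ R₂ R₀ j₁ j₂ α₁ α₂ α₀ h₁ h₂ (u : R₀)
  let f : ↥(milnorPatch R₁ R₂ R₀ j₁ j₂ (α₀.symm (u : R₀))) →ₗ[↥(pbRing R₁ R₂ R₀ j₁ j₂)]
      twModule ↥(pbRing R₁ R₂ R₀ j₁ j₂) (pbRingMap R₁ R₂ R₀ j₁ j₂ α₁ α₂ α₀ h₁ h₂)
        ↥(milnorPatch R₁ R₂ R₀ j₁ j₂ (u : R₀)) :=
    { toFun := fun z => ⟨(α₁ z.1.1, α₂ z.1.2), (hmem z.1).1 z.2⟩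
      map_add' := fun a b =>
        Subtype.ext (Prod.ext (map_add α₁ a.1.1 b.1.1) (map_add α₂ a.1.2 b.1.2))
      map_smul' := fun r a =>
        Subtype.ext (Prod.ext (map_mul α₁ r.1.1 a.1.1) (map_mul α₂ r.1.2 a.1.2)) }
  refine ⟨(LinearEquiv.ofBijective f ⟨fun a b hab => ?_, fun w => ?_⟩).symm⟩
  · have hab' := congrArg Subtype.val hab
    exact Subtype.ext (Prod.ext (α₁.injective (congrArg Prod.fst hab'))
      (α₂.injective (congrArg Prod.snd hab')))
  · obtain ⟨⟨x, y⟩, hw⟩ := w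
    refine ⟨⟨(α₁.symm x, α₂.symm y), (hmem _).2 ?_⟩,
      Subtype.ext (Prod.ext (α₁.apply_symm_apply x) (α₂.apply_symm_apply y))⟩
    simpa using hw

end
end
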